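/- arXiv:1912.00135 — 2 statements merged into one kernel-verified Lean document; each statement's English description precedes it below -/
import Mathlib

section
/- Let N ≥ 1 be an integer, q ∈ (1, ∞), q' = q/(q−1), ρ₊ > 0, ρ₋ > 0, and let ρ : ℝ^N → ℝ be given by ρ(x) = ρ₊ if x_N > 0 and ρ(x) = ρ₋ if x_N ≤ 0. Call a pair (φ, V) a p-pair (1 < p < ∞) if φ : ℝ^N → ℝ is locally integrable, V : ℝ^N → ℝ^N is p-integrable, and ∫_{ℝ^N} φ ∂_j ψ dx = −∫_{ℝ^N} V_j ψ dx for every smooth compactly supported ψ : ℝ^N → ℝ and every j (i.e. V is the distributional gradient of φ). Suppose (u, U) is a q-pair such that ∫_{ℝ^N} ρ(x)^{−1} U(x) · V(x) dx = 0 for every q'-pair (φ, V). Then U = 0 almost everywhere on ℝ^N, and consequently u agrees almost everywhere with a constant. -/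
open Real MeasureTheory
open scoped RealInnerProductSpace ENNReal

/-- A `p`-pair `(φ, V)`: `φ` is locally integrable, `V` is `p`-integrable, and `V` is the
distributional gradient of `φ`. -/
def IsGradPair (N : ℕ) (p : ℝ) (φ : EuclideanSpace ℝ (Fin N) → ℝ)
    (V : EuclideanSpace ℝ (Fin N) → EuclideanSpace ℝ (Fin N)) : Prop :=
  LocallyIntegrable φ volume ∧
  MemLp V (ENNReal.ofReal p) volume ∧
  ∀ ψ : EuclideanSpace ℝ (Fin N) → ℝ, ContDiff ℝ (⊤ : ℕ∞) ψ → HasCompactSupport ψ →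
    ∀ j : Fin N,
      ∫ x, φ x * fderiv ℝ ψ x (EuclideanSpace.single j 1) = -∫ x, V x j * ψ x

open Filter Topology Convolution

theorem nonpos_of_isLocalMax_of_hasDerivAt {g g' : ℝ → ℝ} {t₀ c : ℝ}
    (hg : ∀ t, HasDerivAt g (g' t) t) (hg' : HasDerivAt g' c t₀) (hmax : IsLocalMax g t₀) :
    c ≤ 0 := by
  by_contra! hc
  have hd : deriv g = g' := funext fun t => (hg t).deriv
  have hmin : IsLocalMin g t₀ := by
    refine isLocalMin_of_deriv_deriv_pos ?_ hmax.deriv_eq_zero (hg t₀).continuousAt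
    rwa [hd, hg'.deriv]
  have hconst : g =ᶠ[𝓝 t₀] fun _ => g t₀ := by
    filter_upwards [hmin, hmax] with t h₁ h₂ using le_antisymm h₂ h₁
  have h0 : g' =ᶠ[𝓝 t₀] fun _ => 0 := by
    have := hconst.deriv
    rw [hd] at this
    filter_upwards [this] with t ht
    simpa using ht
  have := h0.deriv_eq
  rw [hg'.deriv, deriv_const] at this
  exact hc.ne' this

section Harmonic

variable {E : Type*} [NormedAddCommGroup E] [InnerProductSpace ℝ E] [FiniteDimensional ℝ E]

/-- A `C²` function with vanishing Laplacian that tends to zero at infinity is nonpositive. -/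
theorem nonpos_of_laplacian_eq_zero_of_tendsto_zero [Nontrivial E] {ι : Type*} [Fintype ι]
    (b : OrthonormalBasis ι ℝ E) {A : E → ℝ} (hA : ContDiff ℝ 2 A)
    (hharm : ∀ y, ∑ i, fderiv ℝ (fun z => fderiv ℝ A z (b i)) y (b i) = 0)
    (hlim : Tendsto A (cocompact E) (𝓝 0)) (y₀ : E) : A y₀ ≤ 0 := by
  by_contra! hpos
  have hι : Nonempty ι := b.toBasis.index_nonempty
  obtain ⟨R, hR⟩ : ∃ R, ∀ y, R < ‖y‖ → A y < A y₀ / 2 := by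
    have := hlim.eventually (gt_mem_nhds (half_pos hpos))
    rw [← Metric.cobounded_eq_cocompact] at this
    obtain ⟨R, -, hR⟩ := (Metric.hasBasis_cobounded_compl_closedBall (0 : E)).eventually_iff.1 this
    exact ⟨R, fun y hy => hR (by simpa using hy)⟩
  set S := max (R + 1) (‖y₀‖ + 1) with hS
  have hSR : R < S := (lt_add_one R).trans_le (le_max_left _ _)
  have hSy : ‖y₀‖ < S := (lt_add_one _).trans_le (le_max_right _ _)
  have hS0 : 0 < S := (norm_nonneg _).trans_lt hSy
  set ε := A y₀ / (4 * S ^ 2) with hε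
  have hε0 : 0 < ε := by positivity
  have hεS : ε * S ^ 2 = A y₀ / 4 := by rw [hε]; field_simp
  obtain ⟨z, hz, hzmax⟩ := (isCompact_closedBall (0 : E) S).exists_isMaxOn
    ⟨y₀, by simpa using hSy.le⟩
    (f := fun y => A y + ε * ‖y‖ ^ 2) (by have := hA.continuous; fun_prop)
  have hzS : ‖z‖ < S := by
    have hz' : ‖z‖ ≤ S := by simpa using hz
    refine hz'.lt_of_ne fun h => ?_
    have h1 := hzmax (show y₀ ∈ Metric.closedBall (0 : E) S by simpa using hSy.le)
    have h2 := hR z (by rw [h]; exact hSR)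
    simp only [Set.mem_ofPred_eq, h, hεS] at h1
    have : 0 ≤ ε * ‖y₀‖ ^ 2 := by positivity
    linarith
  have hloc : IsLocalMax (fun y => A y + ε * ‖y‖ ^ 2) z :=
    hzmax.isLocalMax (mem_of_superset (Metric.isOpen_ball.mem_nhds (by simpa using hzS))
      Metric.ball_subset_closedBall)
  have key : ∀ i, fderiv ℝ (fun y => fderiv ℝ A y (b i)) z (b i) + 2 * ε ≤ 0 := by
    intro i
    have hline : ∀ t : ℝ, HasDerivAt (fun t : ℝ => z + t • b i) (b i) t := fun t => by
      simpa using ((hasDerivAt_id t).smul_const (b i)).const_add z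
    have hA1 : ContDiff ℝ 1 (fun y => fderiv ℝ A y (b i)) :=
      (hA.fderiv_right (m := 1) (by norm_num)).clm_apply contDiff_const
    have hnorm : ∀ t : ℝ, ‖z + t • b i‖ ^ 2 = ‖z‖ ^ 2 + 2 * t * inner ℝ z (b i) + t ^ 2 := by
      intro t
      rw [norm_add_sq_real, inner_smul_right, norm_smul, b.norm_eq_one, mul_one, Real.norm_eq_abs,
        sq_abs]
      ring
    refine nonpos_of_isLocalMax_of_hasDerivAt (t₀ := 0)
      (g := fun t => A (z + t • b i) + ε * ‖z + t • b i‖ ^ 2)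
      (g' := fun t => fderiv ℝ A (z + t • b i) (b i) + ε * (2 * inner ℝ z (b i) + 2 * t))
      (fun t => ?_) ?_ ?_
    · simp only [hnorm]
      have h1 := ((hA.differentiable (by norm_num)) (z + t • b i)).hasFDerivAt.comp_hasDerivAt t
        (hline t)
      have h2 : HasDerivAt (fun t : ℝ => ‖z‖ ^ 2 + 2 * t * inner ℝ z (b i) + t ^ 2)
          (2 * inner ℝ z (b i) + 2 * t) t := by
        have := ((((hasDerivAt_id t).const_mul 2).mul_const (inner ℝ z (b i))).const_add
          (‖z‖ ^ 2)).add ((hasDerivAt_id t).pow 2)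
        exact this.congr_deriv (by simp)
      exact h1.add (h2.const_mul ε)
    · have h1 := ((hA1.differentiable (by norm_num)) (z + (0 : ℝ) • b i)).hasFDerivAt.comp_hasDerivAt
        0 (hline 0)
      have h2 : HasDerivAt (fun t : ℝ => 2 * inner ℝ z (b i) + 2 * t) 2 0 := by
        simpa using ((hasDerivAt_id (0 : ℝ)).const_mul 2).const_add (2 * inner ℝ z (b i))
      have := h1.add (h2.const_mul ε)
      simp only [zero_smul, add_zero] at this
      refine (this.congr_deriv (by ring)).congr_of_eventuallyEq (.of_forall fun t => rfl)
    · have hc : Tendsto (fun t : ℝ => z + t • b i) (𝓝 0) (𝓝 z) := by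
        simpa using (hline 0).continuousAt.tendsto
      have := hc.eventually hloc
      simpa [IsLocalMax, IsMaxFilter] using this
  have hsum := Finset.sum_le_sum fun i (_ : i ∈ Finset.univ) => key i
  rw [Finset.sum_add_distrib, hharm z] at hsum
  simp only [Finset.sum_const, zero_add, nsmul_eq_mul,
    Finset.card_univ] at hsum
  have : (0 : ℝ) < Fintype.card ι := by exact_mod_cast Fintype.card_pos
  nlinarith [mul_pos this hε0]

end Harmonic

section SmoothDerivatives

variable {E : Type*} [NormedAddCommGroup E] [InnerProductSpace ℝ E]

theorem ContDiff.fderiv_apply_const {ψ : E → ℝ} (hψ : ContDiff ℝ (⊤ : ℕ∞) ψ) (v : E) :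
    ContDiff ℝ (⊤ : ℕ∞) fun x => fderiv ℝ ψ x v :=
  (hψ.fderiv_right (m := (⊤ : ℕ∞)) (by norm_cast)).clm_apply contDiff_const

theorem fderiv_fderiv_apply_comm {ψ : E → ℝ} (hψ : ContDiff ℝ (⊤ : ℕ∞) ψ) (v w x : E) :
    fderiv ℝ (fun y => fderiv ℝ ψ y v) x w = fderiv ℝ (fun y => fderiv ℝ ψ y w) x v := by
  have hd : DifferentiableAt ℝ (fderiv ℝ ψ) x :=
    ((hψ.fderiv_right (m := 1) (by norm_cast)).differentiable (by norm_num)) x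
  have hs : IsSymmSndFDerivAt ℝ ψ x :=
    hψ.contDiffAt.isSymmSndFDerivAt (by simp; norm_cast)
  have h1 : ∀ v w, fderiv ℝ (fun y => fderiv ℝ ψ y v) x w = fderiv ℝ (fderiv ℝ ψ) x w v := by
    intro v w
    rw [fderiv_clm_apply hd (differentiableAt_const v)]
    simp
  rw [h1, h1, hs w v]

theorem fderiv_comp_sub_left_apply {ψ : E → ℝ} (hψ : Differentiable ℝ ψ) (y t v : E) :
    fderiv ℝ (fun s => ψ (y - s)) t v = -fderiv ℝ ψ (y - t) v := by
  have h := (hψ (y - t)).hasFDerivAt.comp t ((hasFDerivAt_id (𝕜 := ℝ) t).const_sub y)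
  rw [HasFDerivAt.fderiv (f := fun s => ψ (y - s)) h]
  simp

theorem fderiv_apply_eq_sum {ι : Type*} [Fintype ι] (b : OrthonormalBasis ι ℝ E) (ψ : E → ℝ)
    (x w : E) : fderiv ℝ ψ x w = ∑ i, ⟪w, b i⟫ * fderiv ℝ ψ x (b i) := by
  conv_lhs => rw [← b.sum_repr' w]
  simp [real_inner_comm]

theorem fderiv_comp_linearIsometryEquiv {ψ : E → ℝ} (hψ : Differentiable ℝ ψ) (R : E ≃ₗᵢ[ℝ] E)
    (x v : E) : fderiv ℝ (fun y => ψ (R y)) x v = fderiv ℝ ψ (R x) (R v) := by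
  have h := (hψ (R x)).hasFDerivAt.comp x (R.toContinuousLinearEquiv.hasFDerivAt (x := x))
  rw [HasFDerivAt.fderiv (f := fun y => ψ (R y)) h]
  rfl

end SmoothDerivatives

section Convolution

variable {E : Type*} [NormedAddCommGroup E] [InnerProductSpace ℝ E] [FiniteDimensional ℝ E]
  [MeasurableSpace E] [BorelSpace E]

theorem fderiv_convolution_apply {f h : E → ℝ} (hf : LocallyIntegrable f)
    (hh : ContDiff ℝ (⊤ : ℕ∞) h) (hc : HasCompactSupport h) (y v : E) :
    fderiv ℝ (f ⋆[ContinuousLinearMap.mul ℝ ℝ] h) y v =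
      (f ⋆[ContinuousLinearMap.mul ℝ ℝ] fun x => fderiv ℝ h x v) y := by
  have h1 : ContDiff ℝ 1 h := hh.of_le (by norm_cast)
  rw [(hc.hasFDerivAt_convolution_right _ hf h1 y).fderiv,
    convolution_precompR_apply _ hf (hc.fderiv ℝ) (h1.continuous_fderiv (by norm_num))]

theorem tendsto_convolution_cocompact_zero {f h : E → ℝ} {p p' : ℝ≥0∞} [p.HolderConjugate p']
    (hp : p ≠ ⊤) (hf : MemLp f p) (hh : Continuous h) (hc : HasCompactSupport h) :
    Tendsto (f ⋆[ContinuousLinearMap.mul ℝ ℝ] h) (cocompact E) (𝓝 0) := by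
  rw [Metric.tendsto_nhds]
  intro ε hε
  have hhp : MemLp h p' := hh.memLp_of_hasCompactSupport hc
  set M := (eLpNorm h p' volume).toReal with hM
  have hM0 : 0 ≤ M := ENNReal.toReal_nonneg
  obtain ⟨g, hgc, hgf, hg, hgp⟩ := hf.exists_hasCompactSupport_eLpNorm_sub_le hp
    (ε := ENNReal.ofReal (ε / (M + 1))) (by positivity)
  have hgh : HasCompactSupport (g ⋆[ContinuousLinearMap.mul ℝ ℝ] h) :=  hgc.convolution _ hc
  have h0 : ∀ᶠ y in cocompact E, (g ⋆[ContinuousLinearMap.mul ℝ ℝ] h) y = 0 := by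
    filter_upwards [hgh.isCompact.compl_mem_cocompact] with y hy
      using image_eq_zero_of_notMem_tsupport hy
  filter_upwards [h0] with y hy
  have hshift : MeasurePreserving (fun t : E => y - t) := Measure.measurePreserving_sub_left volume y
  have hhy : MemLp (fun t => h (y - t)) p' := hhp.comp_measurePreserving hshift
  have hhyn : eLpNorm (fun t => h (y - t)) p' volume = eLpNorm h p' volume :=
    eLpNorm_comp_measurePreserving hhp.1 hshift
  have hint : ∀ k : E → ℝ, MemLp k p → Integrable (fun t => k t * h (y - t)) := fun k hk =>
    hk.integrable_mul hhy
  have hsub : (f ⋆[ContinuousLinearMap.mul ℝ ℝ] h) y = ∫ t, (f - g) t * h (y - t) := by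
    rw [← sub_zero ((f ⋆[ContinuousLinearMap.mul ℝ ℝ] h) y), ← hy]
    simp only [convolution_def, ContinuousLinearMap.mul_apply']
    rw [← integral_sub (hint f hf) (hint g hgp)]
    simp [sub_mul]
  rw [dist_zero_right, hsub]
  have hholder : eLpNorm ((f - g) • fun t => h (y - t)) 1 volume ≤
      eLpNorm (f - g) p volume * eLpNorm (fun t => h (y - t)) p' volume :=
    eLpNorm_smul_le_mul_eLpNorm hhy.1 (hf.1.sub hgp.1)
  have hle : ‖∫ t, (f - g) t * h (y - t)‖ₑ ≤
      ENNReal.ofReal (ε / (M + 1)) * eLpNorm h p' volume := by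
    calc _ ≤ eLpNorm (fun t => (f - g) t * h (y - t)) 1 volume := by
          rw [eLpNorm_one_eq_lintegral_enorm]; exact enorm_integral_le_lintegral_enorm _
      _ ≤ eLpNorm (f - g) p volume * eLpNorm (fun t => h (y - t)) p' volume :=
          hholder
      _ ≤ _ := by rw [hhyn]; gcongr
  have hle' := ENNReal.toReal_mono (ENNReal.mul_ne_top ENNReal.ofReal_ne_top hhp.2.ne) hle
  rw [ENNReal.toReal_mul, ENNReal.toReal_ofReal (by positivity), ← hM, toReal_enorm] at hle'
  refine hle'.trans_lt ?_
  rw [div_mul_eq_mul_div, div_lt_iff₀ (by positivity)]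
  nlinarith

/-- **Liouville's theorem** for weakly harmonic functions in `L^p`. -/
theorem ae_eq_zero_of_weakly_harmonic [Nontrivial E] {ι : Type*} [Fintype ι]
    (b : OrthonormalBasis ι ℝ E) {f : E → ℝ} {p p' : ℝ≥0∞} [p.HolderConjugate p']
    (hp : p ≠ ⊤) (hf : MemLp f p)
    (hharm : ∀ ψ : E → ℝ, ContDiff ℝ (⊤ : ℕ∞) ψ → HasCompactSupport ψ →
      ∑ i, ∫ x, f x * fderiv ℝ (fun y => fderiv ℝ ψ y (b i)) x (b i) = 0) :
    ∀ᵐ x, f x = 0 := by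
  have hfl : LocallyIntegrable f := hf.locallyIntegrable (ENNReal.HolderConjugate.one_le (p := p) (q := p'))
  have hle : ∀ h : E → ℝ, ContDiff ℝ (⊤ : ℕ∞) h → HasCompactSupport h →
      ∀ y, (f ⋆[ContinuousLinearMap.mul ℝ ℝ] h) y ≤ 0 := by
    intro h hh hc
    refine nonpos_of_laplacian_eq_zero_of_tendsto_zero b
      ((hc.contDiff_convolution_right _ hfl hh).of_le (by norm_cast)) (fun y => ?_)
      (tendsto_convolution_cocompact_zero (p' := p') hp hf hh.continuous hc)
    have hsub : ContDiff ℝ (⊤ : ℕ∞) fun t : E => y - t := contDiff_const.sub contDiff_id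
    rw [← hharm (fun t => h (y - t)) (hh.comp hsub)
      (hc.comp_homeomorph (Homeomorph.subLeft y))]
    refine Finset.sum_congr rfl fun i _ => ?_
    have hhi := hh.fderiv_apply_const (b i)
    have hci : HasCompactSupport fun x => fderiv ℝ h x (b i) := hc.fderiv_apply ℝ (b i)
    rw [funext fun z => fderiv_convolution_apply hfl hh hc z (b i),
      fderiv_convolution_apply hfl hhi hci]
    simp only [convolution_def, ContinuousLinearMap.mul_apply']
    refine integral_congr_ae (.of_forall fun t => ?_)
    simp only
    rw [funext fun z => fderiv_comp_sub_left_apply (hh.differentiable (by simp)) y z (b i),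
      fderiv_fun_neg, neg_apply, fderiv_comp_sub_left_apply (hhi.differentiable (by simp)), neg_neg]
  refine ae_eq_zero_of_integral_contDiff_smul_eq_zero hfl fun g hg hgc => ?_
  have hneg : ContDiff ℝ (⊤ : ℕ∞) fun t : E => -t := contDiff_id.neg
  have h1 := hle (fun t => g (-t)) (hg.comp hneg) (hgc.comp_homeomorph (Homeomorph.neg E)) 0
  have h2 := hle (fun t => -g (-t)) (hg.comp hneg).neg
    (hgc.comp_homeomorph (Homeomorph.neg E)).neg 0
  simp only [convolution_def, ContinuousLinearMap.mul_apply', zero_sub, neg_neg, mul_neg,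
    integral_neg] at h1 h2
  simp only [smul_eq_mul, mul_comm (g _)]
  linarith

end Convolution

section WeakGradient

variable {E : Type*} [NormedAddCommGroup E] [InnerProductSpace ℝ E] [FiniteDimensional ℝ E]
  [MeasurableSpace E] [BorelSpace E]

/-- `U` is the distributional gradient of `u`, both being locally integrable. -/
structure HasWeakGradient (u : E → ℝ) (U : E → E) : Prop where
  locallyIntegrable : LocallyIntegrable u
  locallyIntegrable_grad : LocallyIntegrable U
  integral_mul_fderiv : ∀ ψ : E → ℝ, ContDiff ℝ (⊤ : ℕ∞) ψ → HasCompactSupport ψ → ∀ v : E,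
    ∫ x, u x * fderiv ℝ ψ x v = -∫ x, ⟪U x, v⟫ * ψ x

theorem MeasureTheory.LocallyIntegrable.inner_const_right {U : E → E} (hU : LocallyIntegrable U)
    (v : E) : LocallyIntegrable fun x => ⟪U x, v⟫ := by
  intro x
  obtain ⟨s, hs, h⟩ := hU x
  exact ⟨s, hs, Integrable.inner_const h v⟩

theorem integrable_inner_mul {U : E → E} (hU : LocallyIntegrable U) (v : E) {g : E → ℝ}
    (hg : Continuous g) (hc : HasCompactSupport g) : Integrable fun x => ⟪U x, v⟫ * g x :=
  (hU.inner_const_right v).integrable_smul_right_of_hasCompactSupport hg hc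

theorem integrable_fderiv_apply {U : E → E} (hU : LocallyIntegrable U) {ψ : E → ℝ}
    (hψ : ContDiff ℝ (⊤ : ℕ∞) ψ) (hc : HasCompactSupport ψ) :
    Integrable fun x => fderiv ℝ ψ x (U x) := by
  simp only [fun x => fderiv_apply_eq_sum (stdOrthonormalBasis ℝ E) ψ x (U x)]
  exact integrable_finsetSum _ fun i _ =>
    integrable_inner_mul hU _ (hψ.fderiv_apply_const _).continuous (hc.fderiv_apply ℝ _)

namespace HasWeakGradient

theorem sub {u w : E → ℝ} {U W : E → E} (hu : HasWeakGradient u U) (hw : HasWeakGradient w W) :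
    HasWeakGradient (fun x => u x - w x) fun x => U x - W x := by
  refine ⟨hu.locallyIntegrable.sub hw.locallyIntegrable,
    hu.locallyIntegrable_grad.sub hw.locallyIntegrable_grad, fun ψ hψ hc v => ?_⟩
  have hD := (hψ.fderiv_apply_const v).continuous
  have hDc : HasCompactSupport fun x => fderiv ℝ ψ x v := hc.fderiv_apply ℝ v
  have hint : ∀ f : E → ℝ, LocallyIntegrable f → Integrable fun x => f x * fderiv ℝ ψ x v :=
    fun f hf => hf.integrable_smul_right_of_hasCompactSupport hD hDc
  simp only [inner_sub_left, sub_mul]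
  rw [integral_sub (hint u hu.locallyIntegrable) (hint w hw.locallyIntegrable),
    integral_sub (integrable_inner_mul hu.locallyIntegrable_grad v hψ.continuous hc)
      (integrable_inner_mul hw.locallyIntegrable_grad v hψ.continuous hc),
    hu.integral_mul_fderiv ψ hψ hc v, hw.integral_mul_fderiv ψ hψ hc v]
  ring

end HasWeakGradient

theorem MeasureTheory.LocallyIntegrable.comp_linearIsometryEquiv {F : Type*}
    [NormedAddCommGroup F] {u : E → F} (hu : LocallyIntegrable u) (R : E ≃ₗᵢ[ℝ] E) :
    LocallyIntegrable fun x => u (R x) := by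
  rw [locallyIntegrable_iff] at hu ⊢
  intro K hK
  have hcomp := R.measurePreserving.integrableOn_comp_preimage
    R.toHomeomorph.measurableEmbedding (f := u) (s := R '' K)
  rw [Set.preimage_image_eq _ R.injective] at hcomp
  exact hcomp.2 (hu _ (hK.image R.continuous))

theorem integral_comp_linearIsometryEquiv (R : E ≃ₗᵢ[ℝ] E) (g : E → ℝ) :
    ∫ x, g (R x) = ∫ x, g x :=
  R.measurePreserving.integral_comp R.toHomeomorph.measurableEmbedding g

namespace HasWeakGradient

theorem comp_linearIsometryEquiv {u : E → ℝ} {U : E → E} (hu : HasWeakGradient u U)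
    (R : E ≃ₗᵢ[ℝ] E) : HasWeakGradient (fun x => u (R x)) fun x => R.symm (U (R x)) := by
  refine ⟨hu.locallyIntegrable.comp_linearIsometryEquiv R, ?_, fun ψ hψ hc v => ?_⟩
  · intro x
    obtain ⟨s, hs, h⟩ := hu.locallyIntegrable_grad.comp_linearIsometryEquiv R x
    exact ⟨s, hs, R.symm.toContinuousLinearEquiv.toContinuousLinearMap.integrable_comp h⟩
  · have hψR : ContDiff ℝ (⊤ : ℕ∞) fun x => ψ (R.symm x) :=
      hψ.comp R.symm.toContinuousLinearEquiv.contDiff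
    have h := hu.integral_mul_fderiv (fun x => ψ (R.symm x)) hψR
      (hc.comp_homeomorph R.symm.toHomeomorph) (R v)
    rw [← integral_comp_linearIsometryEquiv R,
      ← integral_comp_linearIsometryEquiv R (fun x => ⟪U x, R v⟫ * _)] at h
    have hd := hψ.differentiable (by simp)
    simp only [fderiv_comp_linearIsometryEquiv hd R.symm, R.symm_apply_apply] at h
    rw [h]
    simp only [← R.symm.inner_map_map (U _) (R v),
      R.symm_apply_apply]

theorem ae_eq_zero_of_integral_fderiv_eq_zero [Nontrivial E] {w : E → ℝ} {W : E → E}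
    (hw : HasWeakGradient w W) {p p' : ℝ≥0∞} [p.HolderConjugate p'] (hp : p ≠ ⊤) (hW : MemLp W p)
    (hdiv : ∀ ψ : E → ℝ, ContDiff ℝ (⊤ : ℕ∞) ψ → HasCompactSupport ψ →
      ∫ x, fderiv ℝ ψ x (W x) = 0) :
    ∀ᵐ x, W x = 0 := by
  let b := stdOrthonormalBasis ℝ E
  have hcomp : ∀ k, ∀ᵐ x, ⟪W x, b k⟫ = 0 := by
    intro k
    refine ae_eq_zero_of_weakly_harmonic b (p' := p') hp (hW.inner_const (b k))
      fun ψ hψ hc => ?_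
    have hswap : ∀ i, ∫ x, ⟪W x, b k⟫ * fderiv ℝ (fun y => fderiv ℝ ψ y (b i)) x (b i) =
        ∫ x, ⟪W x, b i⟫ * fderiv ℝ (fun y => fderiv ℝ ψ y (b k)) x (b i) := by
      intro i
      have hi := hψ.fderiv_apply_const (b i)
      have hk := hψ.fderiv_apply_const (b k)
      have hci : HasCompactSupport fun y => fderiv ℝ ψ y (b i) := hc.fderiv_apply ℝ _
      have hck : HasCompactSupport fun y => fderiv ℝ ψ y (b k) := hc.fderiv_apply ℝ _
      have h1 := hw.integral_mul_fderiv _ (hi.fderiv_apply_const (b i))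
        (hci.fderiv_apply ℝ _) (b k)
      have h2 := hw.integral_mul_fderiv _ (hk.fderiv_apply_const (b i))
        (hck.fderiv_apply ℝ _) (b i)
      have h3 : ∀ x, fderiv ℝ (fun z => fderiv ℝ (fun y => fderiv ℝ ψ y (b i)) z (b i)) x (b k) =
          fderiv ℝ (fun z => fderiv ℝ (fun y => fderiv ℝ ψ y (b k)) z (b i)) x (b i) := by
        intro x
        rw [fderiv_fderiv_apply_comm hi]
        simp only [fun z => fderiv_fderiv_apply_comm hψ (b i) (b k) z]
      simp only [h3] at h1
      linarith
    rw [Finset.sum_congr rfl fun i _ => hswap i, ← integral_finsetSum]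
    · rw [← hdiv _ (hψ.fderiv_apply_const (b k)) (hc.fderiv_apply ℝ _)]
      exact integral_congr_ae (.of_forall fun x => (fderiv_apply_eq_sum b _ x (W x)).symm)
    · exact fun i _ => integrable_inner_mul hw.locallyIntegrable_grad _
        ((hψ.fderiv_apply_const (b k)).fderiv_apply_const (b i)).continuous
        (HasCompactSupport.fderiv_apply ℝ (hc.fderiv_apply ℝ _) _)
  filter_upwards [ae_all_iff.2 hcomp] with x hx
  rw [← b.sum_repr' (W x)]
  simp [real_inner_comm, hx]

theorem exists_ae_eq_const {u : E → ℝ} (hu : HasWeakGradient u fun _ => 0) :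
    ∃ c : ℝ, ∀ᵐ x, u x = c := by
  have hconst : ∀ h : E → ℝ, ContDiff ℝ (⊤ : ℕ∞) h → HasCompactSupport h → ∀ y,
      (u ⋆[ContinuousLinearMap.mul ℝ ℝ] h) y = (u ⋆[ContinuousLinearMap.mul ℝ ℝ] h) 0 := by
    intro h hh hc y
    refine is_const_of_fderiv_eq_zero (𝕜 := ℝ)
      ((hc.contDiff_convolution_right _ hu.locallyIntegrable hh).differentiable (by simp))
      (fun z => ?_) y 0
    ext v
    rw [fderiv_convolution_apply hu.locallyIntegrable hh hc]
    have hsub : ContDiff ℝ (⊤ : ℕ∞) fun t : E => z - t := contDiff_const.sub contDiff_id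
    have h1 := hu.integral_mul_fderiv (fun t => h (z - t)) (hh.comp hsub)
      (hc.comp_homeomorph (Homeomorph.subLeft z)) v
    simp only [fderiv_comp_sub_left_apply (hh.differentiable (by simp)), mul_neg, integral_neg,
      inner_zero_left, zero_mul, integral_zero, neg_zero, neg_eq_zero] at h1
    simpa [convolution_def] using h1
  let φ : ℕ → ContDiffBump (0 : E) := fun n =>
    ⟨1 / ((n : ℝ) + 1), 2 * (1 / ((n : ℝ) + 1)), by positivity, by
      have : 0 < 1 / ((n : ℝ) + 1) := by positivity
      linarith⟩
  have hφ : Tendsto (fun n => (φ n).rOut) atTop (𝓝 0) := by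
    simpa [φ] using (tendsto_one_div_add_atTop_nhds_zero_nat (𝕜 := ℝ)).const_mul 2
  have hae := ContDiffBump.ae_convolution_tendsto_right_of_locallyIntegrable (μ := volume)
    (K := 2) hφ (.of_forall fun n => le_rfl) hu.locallyIntegrable
  have hflip : ∀ n x, ((φ n).normed volume ⋆[ContinuousLinearMap.lsmul ℝ ℝ] u) x =
      (u ⋆[ContinuousLinearMap.mul ℝ ℝ] (φ n).normed volume) 0 := by
    intro n x
    rw [← hconst _ (φ n).contDiff_normed (φ n).hasCompactSupport_normed x,
      ← convolution_flip]
    congr 1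
    ext
    simp
  obtain ⟨x₀, hx₀⟩ := hae.exists
  refine ⟨u x₀, ?_⟩
  filter_upwards [hae] with x hx
  simp only [hflip] at hx hx₀
  exact tendsto_nhds_unique hx hx₀

end HasWeakGradient

end WeakGradient

section Hyperplane

variable {E : Type*} [NormedAddCommGroup E] [InnerProductSpace ℝ E]

theorem norm_ite_inner_pos_le (e : E) (a b : ℝ) (x : E) :
    ‖(if 0 < ⟪e, x⟫ then a else b : ℝ)‖ ≤ max |a| |b| := by
  split_ifs <;> simp

/-- Multiplying a Lipschitz function that vanishes on a hyperplane by a function that is constant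
on each side of the hyperplane yields a Lipschitz function. -/
theorem exists_lipschitzWith_ite_inner_pos_mul {e : E} (he : ‖e‖ = 1) (a b : ℝ) {ψ : E → ℝ}
    {K : NNReal} (hψ : LipschitzWith K ψ) (h0 : ∀ x, ⟪e, x⟫ = 0 → ψ x = 0) :
    ∃ L, LipschitzWith L fun x => (if 0 < ⟪e, x⟫ then a else b) * ψ x := by
  set M := max |a| |b|
  have hM : 0 ≤ M := (abs_nonneg a).trans (le_max_left _ _)
  have hb : ∀ x, |ψ x| ≤ K * |⟪e, x⟫| := by
    intro x
    have h := hψ.dist_le_mul x (x - ⟪e, x⟫ • e)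
    rw [h0 (x - ⟪e, x⟫ • e) (by simp [inner_sub_right, inner_smul_right, he])] at h
    simpa [dist_eq_norm, norm_smul, he] using h
  have hin : ∀ x y : E, |⟪e, x⟫ - ⟪e, y⟫| ≤ dist x y := by
    intro x y
    rw [← inner_sub_right, dist_eq_norm]
    simpa [he] using abs_real_inner_le_norm e (x - y)
  have hsame : ∀ (c : ℝ) (x y : E), |c| ≤ M → dist (c * ψ x) (c * ψ y) ≤ M * K * dist x y := by
    intro c x y hc
    rw [Real.dist_eq, ← mul_sub, abs_mul, mul_assoc]
    exact mul_le_mul hc (hψ.dist_le_mul x y) (abs_nonneg _) hM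
  have hopp : ∀ (c d : ℝ) (x y : E), |c| ≤ M → |d| ≤ M → 0 < ⟪e, x⟫ → ⟪e, y⟫ ≤ 0 →
      dist (c * ψ x) (d * ψ y) ≤ M * K * dist x y := by
    intro c d x y hc hd hx hy
    calc dist (c * ψ x) (d * ψ y) ≤ |c * ψ x| + |d * ψ y| := by
          rw [Real.dist_eq]; exact abs_sub _ _
      _ ≤ M * (K * |⟪e, x⟫|) + M * (K * |⟪e, y⟫|) := by
          rw [abs_mul, abs_mul]
          gcongr
          exacts [hb x, hb y]
      _ = M * K * |⟪e, x⟫ - ⟪e, y⟫| := by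
          rw [abs_of_pos hx, abs_of_nonpos hy, abs_of_pos (by linarith)]
          ring
      _ ≤ M * K * dist x y := by
          gcongr
          exact hin x y
  refine ⟨⟨M * K, by positivity⟩, LipschitzWith.of_dist_le_mul fun x y => ?_⟩
  change _ ≤ M * K * dist x y
  by_cases hx : 0 < ⟪e, x⟫ <;> by_cases hy : 0 < ⟪e, y⟫ <;> simp only [hx, hy, if_true, if_false]
  · exact hsame a x y (le_max_left _ _)
  · exact hopp a b x y (le_max_left _ _) (le_max_right _ _) hx (not_lt.1 hy)
  · rw [dist_comm, dist_comm x]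
    exact hopp a b y x (le_max_left _ _) (le_max_right _ _) hy (not_lt.1 hx)
  · exact hsame b x y (le_max_right _ _)

end Hyperplane

section TwoPhase

variable {E : Type*} [NormedAddCommGroup E] [InnerProductSpace ℝ E] [FiniteDimensional ℝ E]
  [MeasurableSpace E] [BorelSpace E]

theorem ae_inner_ne_zero {e : E} (he : ‖e‖ = 1) : ∀ᵐ x : E, ⟪e, x⟫ ≠ 0 := by
  have hne : (ℝ ∙ e)ᗮ ≠ ⊤ := by
    intro h
    have : e ∈ (ℝ ∙ e)ᗮ := h ▸ Submodule.mem_top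
    rw [Submodule.mem_orthogonal_singleton_iff_inner_right, real_inner_self_eq_norm_sq, he] at this
    norm_num at this
  have h0 := Measure.addHaar_submodule volume _ hne
  rw [ae_iff]
  convert h0 using 2
  ext x
  simp [Submodule.mem_orthogonal_singleton_iff_inner_right]

theorem measurable_ite_inner_pos (e : E) (a b : ℝ) :
    Measurable fun x : E => if 0 < ⟪e, x⟫ then a else b :=
  Measurable.ite (measurableSet_lt measurable_const (by fun_prop)) measurable_const
    measurable_const

theorem ae_eventually_ite_inner_pos_eq {e : E} (he : ‖e‖ = 1) (a b : ℝ) :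
    ∀ᵐ x : E, ∀ᶠ y in 𝓝 x, (if 0 < ⟪e, y⟫ then a else b) = if 0 < ⟪e, x⟫ then a else b := by
  have hcont : Continuous fun y : E => ⟪e, y⟫ := by fun_prop
  filter_upwards [ae_inner_ne_zero he] with x hx
  rcases hx.lt_or_gt with h | h
  · filter_upwards [hcont.continuousAt.eventually (gt_mem_nhds h)] with y hy
    simp [hy.not_gt, h.not_gt]
  · filter_upwards [hcont.continuousAt.eventually (lt_mem_nhds h)] with y hy
    simp [hy, h]

theorem integral_mul_fderiv_eq_neg_of_ae_locally_const {c ψ η : E → ℝ} {L : NNReal}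
    (hc : ∀ᵐ x : E, ∀ᶠ y in 𝓝 x, c y = c x) (hψ : ContDiff ℝ (⊤ : ℕ∞) ψ)
    (hL : LipschitzWith L fun x => c x * ψ x) (hη : ContDiff ℝ (⊤ : ℕ∞) η)
    (hηc : HasCompactSupport η) (v : E) :
    ∫ x, c x * ψ x * fderiv ℝ η x v = -∫ x, c x * fderiv ℝ ψ x v * η x := by
  obtain ⟨D, hD⟩ := (hη.of_le (by norm_cast) : ContDiff ℝ 1 η).lipschitzWith_of_hasCompactSupport
    hηc (by norm_num)
  have h := hL.integral_lineDeriv_mul_eq (μ := volume) hD hηc v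
  have h1 : ∀ᵐ x, lineDeriv ℝ (fun x => c x * ψ x) x v = c x * fderiv ℝ ψ x v := by
    filter_upwards [hc] with x hx
    have heq : (fun y => c y * ψ y) =ᶠ[𝓝 x] fun y => c x * ψ y := by
      filter_upwards [hx] with y hy
      rw [hy]
    have hd : DifferentiableAt ℝ ψ x := hψ.differentiable (by simp) x
    rw [heq.lineDeriv_eq, (hd.const_mul (c x)).lineDeriv_eq_fderiv, fderiv_const_mul hd]
    simp
  have h2 : ∀ x, lineDeriv ℝ η x (-v) = -fderiv ℝ η x v := fun x => by
    rw [(hη.differentiable (by simp) x).lineDeriv_eq_fderiv, map_neg]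
  simp only [h2] at h
  rw [integral_congr_ae (h1.mono fun x hx => by simp only [hx] :
    _ =ᵐ[volume] fun x => c x * fderiv ℝ ψ x v * η x)] at h
  rw [h, ← integral_neg]
  exact integral_congr_ae (.of_forall fun x => by simp only; ring)

/-- Uniqueness for the two-phase problem with interface the hyperplane orthogonal to `e`, phrased
in terms of smooth test functions. -/
theorem HasWeakGradient.ae_eq_zero_of_twoPhase {e : E} (he : ‖e‖ = 1) {ρp ρm : ℝ} (hρp : 0 < ρp)
    (hρm : 0 < ρm) {u : E → ℝ} {U : E → E} (hu : HasWeakGradient u U) {p p' : ℝ≥0∞}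
    [p.HolderConjugate p'] (hp : p ≠ ⊤) (hU : MemLp U p)
    (hweight : ∀ ψ : E → ℝ, ContDiff ℝ (⊤ : ℕ∞) ψ → HasCompactSupport ψ →
      ∫ x, (if 0 < ⟪e, x⟫ then ρp else ρm)⁻¹ * fderiv ℝ ψ x (U x) = 0)
    (hvanish : ∀ ψ : E → ℝ, ContDiff ℝ (⊤ : ℕ∞) ψ → HasCompactSupport ψ →
      (∀ x, ⟪e, x⟫ = 0 → ψ x = 0) → ∫ x, fderiv ℝ ψ x (U x) = 0) :
    ∀ᵐ x, U x = 0 := by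
  have : Nontrivial E := ⟨e, 0, fun h => by simp [h] at he⟩
  let R : E ≃ₗᵢ[ℝ] E := (ℝ ∙ e)ᗮ.reflection
  have hRR : ∀ x, R (R x) = x := Submodule.reflection_reflection _
  have hRs : ∀ x, R.symm x = R x := fun x => by rw [LinearIsometryEquiv.symm_apply_eq, hRR]
  have hRe : ∀ x, ⟪e, R x⟫ = -⟪e, x⟫ := by
    intro x
    rw [← R.inner_map_map, hRR, Submodule.reflection_orthogonalComplement_singleton_eq_neg,
      inner_neg_left]
  have hfix : ∀ x, ⟪e, x⟫ = 0 → R x = x := fun x hx =>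
    Submodule.reflection_mem_subspace_eq_self
      (Submodule.mem_orthogonal_singleton_iff_inner_right.2 hx)
  have hcompR : ∀ ψ : E → ℝ, ContDiff ℝ (⊤ : ℕ∞) ψ → ContDiff ℝ (⊤ : ℕ∞) fun x => ψ (R x) :=
    fun ψ hψ => hψ.comp R.toContinuousLinearEquiv.contDiff
  have hcompRc : ∀ ψ : E → ℝ, HasCompactSupport ψ → HasCompactSupport fun x => ψ (R x) :=
    fun ψ hc => hc.comp_homeomorph R.toHomeomorph
  have hUR := hu.comp_linearIsometryEquiv R
  have hMR : MemLp (fun x => R.symm (U (R x))) p :=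
    R.symm.toContinuousLinearEquiv.toContinuousLinearMap.comp_memLp'
      (hU.comp_measurePreserving R.measurePreserving)
  have hsymm : ∀ᵐ x, U x - R.symm (U (R x)) = 0 := by
    refine (hu.sub hUR).ae_eq_zero_of_integral_fderiv_eq_zero (p' := p') hp (hU.sub hMR)
      fun ψ hψ hc => ?_
    have hd := hψ.differentiable (by simp)
    have hdR := (hcompR ψ hψ).differentiable (by simp)
    rw [← hvanish (fun x => ψ x - ψ (R x)) (hψ.sub (hcompR ψ hψ)) (hc.sub (hcompRc ψ hc))
      fun x hx => by rw [hfix x hx, sub_self]]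
    simp only [map_sub, fderiv_fun_sub (hd _) (hdR _), sub_apply]
    rw [integral_sub (integrable_fderiv_apply hu.locallyIntegrable_grad hψ hc)
        (integrable_fderiv_apply hUR.locallyIntegrable_grad hψ hc),
      integral_sub (integrable_fderiv_apply hu.locallyIntegrable_grad hψ hc)
        (integrable_fderiv_apply hu.locallyIntegrable_grad (hcompR ψ hψ) (hcompRc ψ hc)),
      ← integral_comp_linearIsometryEquiv R (fun x => fderiv ℝ (fun y => ψ (R y)) x (U x))]
    simp only [fderiv_comp_linearIsometryEquiv hd, hRR, hRs]
  have hUeq : ∀ᵐ x, R (U (R x)) = U x := by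
    filter_upwards [hsymm] with x hx
    rw [← hRs, ← sub_eq_zero.1 hx]
  refine hu.ae_eq_zero_of_integral_fderiv_eq_zero (p' := p') hp hU fun ψ hψ hc => ?_
  have hd := hψ.differentiable (by simp)
  have hint := integrable_fderiv_apply hu.locallyIntegrable_grad hψ hc
  have h1 := hweight ψ hψ hc
  have h2 := hweight _ (hcompR ψ hψ) (hcompRc ψ hc)
  rw [← integral_comp_linearIsometryEquiv R] at h2
  simp only [fderiv_comp_linearIsometryEquiv hd, hRR, hRe] at h2
  rw [integral_congr_ae (hUeq.mono fun x hx => by simp only [hx] : _ =ᵐ[volume] fun x =>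
    (if 0 < -⟪e, x⟫ then ρp else ρm)⁻¹ * fderiv ℝ ψ x (U x))] at h2
  have hbdd : ∀ d : E, Integrable fun x =>
      (if 0 < ⟪d, x⟫ then ρp else ρm)⁻¹ * fderiv ℝ ψ x (U x) := by
    intro d
    simp only [fun x : E => apply_ite (·⁻¹) (0 < ⟪d, x⟫) ρp ρm]
    exact hint.bdd_mul (measurable_ite_inner_pos d _ _).aestronglyMeasurable
      (.of_forall (norm_ite_inner_pos_le d _ _))
  have hneg := hbdd (-e)
  simp only [inner_neg_left] at hneg
  have hsum : ∫ x, (ρp⁻¹ + ρm⁻¹) * fderiv ℝ ψ x (U x) = 0 := by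
    have h12 := integral_add (hbdd e) hneg
    rw [h1, h2, add_zero] at h12
    rw [← h12]
    refine integral_congr_ae ?_
    filter_upwards [ae_inner_ne_zero he] with x hx
    rcases hx.lt_or_gt with h | h
    · simp only [h.not_gt, neg_pos.2 h, if_true, if_false]
      ring
    · simp only [h, (neg_neg_of_pos h).not_gt, if_true, if_false]
      ring
  rw [integral_const_mul] at hsum
  exact (mul_eq_zero.1 hsum).resolve_left (by positivity)

end TwoPhase

section GradPair

variable {N : ℕ}

theorem EuclideanSpace.apply_eq_inner_single (x : EuclideanSpace ℝ (Fin N)) (j : Fin N) :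
    x j = ⟪EuclideanSpace.single j (1 : ℝ), x⟫ := by
  simp [EuclideanSpace.inner_single_left]

theorem IsGradPair.hasWeakGradient {p : ℝ} (hp : 1 ≤ p) {u : EuclideanSpace ℝ (Fin N) → ℝ}
    {U : EuclideanSpace ℝ (Fin N) → EuclideanSpace ℝ (Fin N)} (h : IsGradPair N p u U) :
    HasWeakGradient u U := by
  obtain ⟨hu, hU, hparts⟩ := h
  have hUl : LocallyIntegrable U := hU.locallyIntegrable (by simpa using hp)
  refine ⟨hu, hUl, fun ψ hψ hc v => ?_⟩
  let b := EuclideanSpace.basisFun (Fin N) ℝ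
  have h1 : ∀ x, u x * fderiv ℝ ψ x v =
      ∑ j, ⟪v, b j⟫ * (u x * fderiv ℝ ψ x (EuclideanSpace.single j 1)) := by
    intro x
    rw [fderiv_apply_eq_sum b, Finset.mul_sum]
    refine Finset.sum_congr rfl fun j _ => ?_
    simp only [b, EuclideanSpace.basisFun_apply]
    ring
  have h2 : ∀ x, ⟪U x, v⟫ * ψ x = ∑ j, ⟪v, b j⟫ * (U x j * ψ x) := by
    intro x
    rw [← b.sum_inner_mul_inner (U x) v, Finset.sum_mul]
    refine Finset.sum_congr rfl fun j _ => ?_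
    simp only [b, EuclideanSpace.basisFun_apply, EuclideanSpace.apply_eq_inner_single (U x) j,
      real_inner_comm]
    ring
  have hint : ∀ j, Integrable fun x => U x j * ψ x := fun j => by
    simp only [EuclideanSpace.apply_eq_inner_single (U _) j, real_inner_comm (U _)]
    exact integrable_inner_mul hUl _ hψ.continuous hc
  simp only [h1, h2]
  rw [integral_finsetSum _ fun j _ => ?_, integral_finsetSum _ fun j _ => (hint j).const_mul _,
    ← Finset.sum_neg_distrib]
  · refine Finset.sum_congr rfl fun j _ => ?_
    rw [integral_const_mul, integral_const_mul, hparts ψ hψ hc j, mul_neg]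
  · exact (hu.integrable_smul_right_of_hasCompactSupport
      (hψ.fderiv_apply_const (EuclideanSpace.single j 1)).continuous
      (hc.fderiv_apply ℝ _)).const_mul _

theorem isGradPair_mul_gradient {p : ℝ} {c ψ : EuclideanSpace ℝ (Fin N) → ℝ} {L : NNReal} {C : ℝ}
    (hcm : Measurable c) (hcb : ∀ x, ‖c x‖ ≤ C) (hc : ∀ᵐ x, ∀ᶠ y in 𝓝 x, c y = c x)
    (hψ : ContDiff ℝ (⊤ : ℕ∞) ψ) (hψc : HasCompactSupport ψ)
    (hL : LipschitzWith L fun x => c x * ψ x) :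
    IsGradPair N p (fun x => c x * ψ x) fun x => c x • gradient ψ x := by
  have hgrad : Continuous (gradient ψ) :=
    (InnerProductSpace.toDual ℝ _).symm.continuous.comp (hψ.continuous_fderiv (by simp))
  have hgradc : HasCompactSupport (gradient ψ) :=
    (hψc.fderiv ℝ).comp_left (map_zero (InnerProductSpace.toDual ℝ _).symm)
  refine ⟨hL.continuous.locallyIntegrable, ?_, fun η hη hηc j => ?_⟩
  · have hm : MemLp (gradient ψ) (ENNReal.ofReal p) := hgrad.memLp_of_hasCompactSupport hgradc
    refine hm.of_le_mul (c := C) (hcm.aestronglyMeasurable.smul hm.1) (.of_forall fun x => ?_)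
    rw [norm_smul]
    gcongr
    exact hcb x
  · rw [integral_mul_fderiv_eq_neg_of_ae_locally_const hc hψ hL hη hηc]
    congr 2
    ext x
    rw [PiLp.smul_apply, smul_eq_mul, EuclideanSpace.apply_eq_inner_single (gradient ψ x) j,
      real_inner_comm, inner_gradient_left]

end GradPair

/-- Theorem 3.5, uniqueness part: if a `q`-pair `(u, U)` satisfies
`∫ ρ⁻¹ U · V = 0` for every `q'`-pair `(φ, V)`, then `U = 0` a.e. and `u` is a.e. constant. -/
theorem stmt_14 (N : ℕ) (hN : 1 ≤ N) (q : ℝ) (hq : 1 < q)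
    (ρp ρm : ℝ) (hρp : 0 < ρp) (hρm : 0 < ρm)
    (u : EuclideanSpace ℝ (Fin N) → ℝ)
    (U : EuclideanSpace ℝ (Fin N) → EuclideanSpace ℝ (Fin N))
    (hpair : IsGradPair N q u U)
    (horth : ∀ φ V, IsGradPair N (q / (q - 1)) φ V →
      (∫ x : EuclideanSpace ℝ (Fin N),
        (if 0 < x ⟨N - 1, by omega⟩ then ρp else ρm)⁻¹ * ⟪U x, V x⟫) = 0) :
    (∀ᵐ x : EuclideanSpace ℝ (Fin N), U x = 0) ∧
    ∃ c : ℝ, ∀ᵐ x : EuclideanSpace ℝ (Fin N), u x = c := by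
  let e : EuclideanSpace ℝ (Fin N) := EuclideanSpace.single ⟨N - 1, by omega⟩ 1
  have he : ‖e‖ = 1 := by simp [e]
  have hconj : q.HolderConjugate (q / (q - 1)) := Real.HolderConjugate.conjExponent hq
  have : (ENNReal.ofReal q).HolderConjugate (ENNReal.ofReal (q / (q - 1))) :=
    hconj.ennrealOfReal
  have hu := hpair.hasWeakGradient hq.le
  simp only [fun x : EuclideanSpace ℝ (Fin N) =>
    EuclideanSpace.apply_eq_inner_single x ⟨N - 1, by omega⟩] at horth
  have hU : ∀ᵐ x, U x = 0 := by
    refine hu.ae_eq_zero_of_twoPhase he hρp hρm (p' := ENNReal.ofReal (q / (q - 1)))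
      ENNReal.ofReal_ne_top hpair.2.1 (fun ψ hψ hc => ?_) fun ψ hψ hc h0 => ?_
    · obtain ⟨L, hL⟩ := (hψ.of_le (by norm_cast) :
        ContDiff ℝ 1 ψ).lipschitzWith_of_hasCompactSupport hc (by norm_num)
      have h := horth _ _ (isGradPair_mul_gradient (c := fun _ => 1) (C := 1) measurable_const
        (by simp) (.of_forall fun _ => .of_forall fun _ => rfl) hψ hc (by simpa using hL))
      simpa only [one_smul, inner_gradient_right, conj_trivial] using h
    · obtain ⟨K, hK⟩ := (hψ.of_le (by norm_cast) :
        ContDiff ℝ 1 ψ).lipschitzWith_of_hasCompactSupport hc (by norm_num)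
      obtain ⟨L, hL⟩ := exists_lipschitzWith_ite_inner_pos_mul he ρp ρm hK h0
      have h := horth _ _ (isGradPair_mul_gradient (measurable_ite_inner_pos e ρp ρm)
        (norm_ite_inner_pos_le e ρp ρm) (ae_eventually_ite_inner_pos_eq he ρp ρm) hψ hc hL)
      rw [← h]
      refine integral_congr_ae (.of_forall fun x => ?_)
      have hne : (if 0 < ⟪e, x⟫ then ρp else ρm) ≠ 0 := by split_ifs <;> positivity
      simp only [inner_smul_right, inner_gradient_right]
      exact (inv_mul_cancel_left₀ hne _).symm
  refine ⟨hU, HasWeakGradient.exists_ae_eq_const ⟨hu.locallyIntegrable, locallyIntegrable_const 0,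
    fun ψ hψ hc v => ?_⟩⟩
  rw [hu.integral_mul_fderiv ψ hψ hc v]
  congr 1
  exact integral_congr_ae (hU.mono fun x hx => by simp only [hx])
end

section
/- Let N ≥ 1 be an integer and q ∈ (1, ∞). Suppose f : ℝ^N_+ → ℝ^N, g : ℝ^N_+ → ℝ, and h : ℝ^N_+ → ℝ^N are q-integrable and satisfy, for every smooth function ψ : ℝ^N → ℝ whose support is a compact subset of the open half-space ℝ^N_+: ∫_{ℝ^N_+} f · ∇ψ dx = −∫_{ℝ^N_+} g ψ dx (so g is the distributional divergence of f), and ∫_{ℝ^N_+} f_N ∂_j ψ dx = −∫_{ℝ^N_+} h_j ψ dx for each j = 1, …, N (so h is the distributional gradient of the last component f_N). Then for every δ > 0 there exists a smooth compactly supported F : ℝ^N → ℝ^N such that ‖F − f‖_{L^q(ℝ^N_+)} + ‖div F − g‖_{L^q(ℝ^N_+)} + ‖F_N − f_N‖_{L^q(ℝ^N_+)} + ‖∇F_N − h‖_{L^q(ℝ^N_+)} < δ, where div F and ∇F_N are the classical divergence and gradient of F restricted to ℝ^N_+. -/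
open Real MeasureTheory
open scoped ENNReal

/-- The `L^p` norm (real exponent `p`) of `f` with respect to the measure `μ`. -/
noncomputable def LqNorm {α : Type*} [MeasurableSpace α] {E : Type*} [NormedAddCommGroup E]
    (μ : Measure α) (p : ℝ) (f : α → E) : ℝ :=
  (∫ x, ‖f x‖ ^ p ∂μ) ^ (1 / p)

/-- The open upper half-space `ℝ^N_+ = {x : x_N > 0}`. -/
def upperHalf (N : ℕ) (hN : 1 ≤ N) : Set (EuclideanSpace ℝ (Fin N)) :=
  {x | 0 < x ⟨N - 1, by omega⟩}

section Mollification

variable {G E : Type*} [NormedAddCommGroup G] [NormedSpace ℝ G] [FiniteDimensional ℝ G]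
  [MeasurableSpace G] [BorelSpace G] {μ : Measure G} [μ.IsAddHaarMeasure]
  [NormedAddCommGroup E]

/-- Translation is continuous in `L^p` for `1 ≤ p < ∞`. -/
theorem MeasureTheory.MemLp.exists_eLpNorm_translate_sub_le {p : ℝ≥0∞} (hp : 1 ≤ p) (hp' : p ≠ ∞)
    {u : G → E} (hu : MemLp u p μ) {ε : ℝ≥0∞} (hε : ε ≠ 0) :
    ∃ r : ℝ, 0 < r ∧ ∀ t : G, ‖t‖ < r → eLpNorm (fun x => u (x - t) - u x) p μ ≤ ε := by
  have : Fact (1 ≤ p) := ⟨hp⟩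
  let g : G → C(G, G) := fun t => ⟨fun x => x - t, by fun_prop⟩
  have hg : Continuous g :=
    (ContinuousMap.mk (fun a : G × G => a.2 - a.1) (by fun_prop)).curry.continuous
  have hgm : ∀ t, MeasurePreserving (g t) μ μ := fun t => measurePreserving_sub_right μ t
  have hc := (continuous_const (y := hu.toLp u)).compMeasurePreservingLp hg hgm hp'
  have := (EMetric.tendsto_nhds.1 (hc.tendsto 0)) ε (pos_iff_ne_zero.2 hε)
  obtain ⟨r, hr, h⟩ := Metric.eventually_nhds_iff.1 this
  refine ⟨r, hr, fun t ht => ?_⟩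
  have h1 := (h (y := t) (by simpa using ht)).le
  rw [Lp.toLp_compMeasurePreserving hu, Lp.toLp_compMeasurePreserving hu,
    Lp.edist_toLp_toLp] at h1
  convert! h1 using 2
  ext x
  simp [g]

/-- Minkowski's inequality for the difference between a function and a weighted average of
its translates. -/
theorem eLpNorm_integral_smul_translate_sub_le [NormedSpace ℝ E] [CompleteSpace E] {q : ℝ}
    (hq : 1 ≤ q) {u : G → E}
    (hu : MemLp u (ENNReal.ofReal q) μ) {φ : G → ℝ} (hφ : Continuous φ)
    (hφc : HasCompactSupport φ) (hφ0 : ∀ t, 0 ≤ φ t) (hφ1 : ∫ t, φ t ∂μ = 1) {ε : ℝ≥0∞}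
    (h : ∀ t, φ t ≠ 0 → eLpNorm (fun x => u (x - t) - u x) (ENNReal.ofReal q) μ ≤ ε) :
    eLpNorm (fun x => ∫ t, φ t • u (x - t) ∂μ - u x) (ENNReal.ofReal q) μ ≤ ε := by
  have hq0 : 0 < q := by linarith
  have hp0 : ENNReal.ofReal q ≠ 0 := by simpa using hq0
  have hlp : ∀ w : G → E, eLpNorm w (ENNReal.ofReal q) μ ≤ ε ↔
      ∫⁻ x, ‖w x‖ₑ ^ q ∂μ ≤ ε ^ q := fun w => by
    rw [eLpNorm_eq_lintegral_rpow_enorm_toReal hp0 ENNReal.ofReal_ne_top,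
      ENNReal.toReal_ofReal hq0.le, one_div, ENNReal.rpow_inv_le_iff hq0]
  have hφint : Integrable φ μ := hφ.integrable_of_hasCompactSupport hφc
  have hmass : ∫⁻ t, ‖φ t‖ₑ ∂μ = 1 := by
    rw [← ofReal_integral_norm_eq_lintegral_enorm hφint]
    simp [abs_of_nonneg (hφ0 _), hφ1]
  let ν : Measure G := μ.withDensity (fun t => ‖φ t‖ₑ)
  have : IsProbabilityMeasure ν := ⟨by simp [ν, hmass]⟩
  have hν : ∀ w : G → ℝ≥0∞, ∫⁻ t, w t ∂ν = ∫⁻ t, ‖φ t‖ₑ * w t ∂μ := fun w =>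
    lintegral_withDensity_eq_lintegral_mul_non_measurable μ hφ.measurable.enorm
      (Filter.Eventually.of_forall fun _ => enorm_lt_top) w
  have hloc : LocallyIntegrable u μ := hu.locallyIntegrable (by simpa using hq)
  have hpt : ∀ x, ‖∫ t, φ t • u (x - t) ∂μ - u x‖ₑ ^ q ≤
      ∫⁻ t, ‖φ t‖ₑ * ‖u (x - t) - u x‖ₑ ^ q ∂μ := fun x => by
    have h1 : ∫ t, φ t • u (x - t) ∂μ - u x = ∫ t, φ t • (u (x - t) - u x) ∂μ := by
      have hi : Integrable (fun t => φ t • u (x - t)) μ :=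
        hφc.convolutionExists_left (ContinuousLinearMap.lsmul ℝ ℝ) hφ hloc x
      simp_rw [smul_sub]
      rw [integral_sub hi (hφint.smul_const _), integral_smul_const, hφ1, one_smul]
    have hm : AEStronglyMeasurable (fun t => u (x - t) - u x) ν :=
      ((hu.1.comp_quasiMeasurePreserving
        (quasiMeasurePreserving_sub_left_of_right_invariant μ x)).sub
          aestronglyMeasurable_const).mono_ac (withDensity_absolutelyContinuous _ _)
    have h2 : ‖∫ t, φ t • (u (x - t) - u x) ∂μ‖ₑ ≤ ∫⁻ t, ‖u (x - t) - u x‖ₑ ∂ν := by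
      refine (enorm_integral_le_lintegral_enorm _).trans_eq ?_
      rw [hν]
      simp [enorm_smul]
    have h3 := eLpNorm'_le_eLpNorm'_of_exponent_le one_pos hq ν hm
    simp only [eLpNorm', ENNReal.rpow_one, div_one] at h3
    rw [h1, ← hν]
    rw [one_div, ENNReal.le_rpow_inv_iff hq0] at h3
    exact (ENNReal.rpow_le_rpow h2 hq0.le).trans h3
  rw [hlp]
  have hmeas : AEMeasurable (Function.uncurry fun x t => ‖φ t‖ₑ * ‖u (x - t) - u x‖ₑ ^ q)
      (μ.prod μ) := by
    have h1 : AEStronglyMeasurable (fun z : G × G => u (z.1 - z.2)) (μ.prod μ) :=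
      hu.1.comp_quasiMeasurePreserving
        (quasiMeasurePreserving_sub_of_right_invariant μ μ)
    have h2 : AEStronglyMeasurable (fun z : G × G => u z.1) (μ.prod μ) := hu.1.comp_fst
    exact ((hφ.comp continuous_snd).measurable.enorm.aemeasurable).mul
      ((h1.sub h2).enorm.pow_const q)
  calc ∫⁻ x, ‖∫ t, φ t • u (x - t) ∂μ - u x‖ₑ ^ q ∂μ
      ≤ ∫⁻ x, ∫⁻ t, ‖φ t‖ₑ * ‖u (x - t) - u x‖ₑ ^ q ∂μ ∂μ := lintegral_mono hpt
    _ = ∫⁻ t, ∫⁻ x, ‖φ t‖ₑ * ‖u (x - t) - u x‖ₑ ^ q ∂μ ∂μ := lintegral_lintegral_swap hmeas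
    _ ≤ ∫⁻ t, ‖φ t‖ₑ * ε ^ q ∂μ := by
        refine lintegral_mono fun t => ?_
        rw [lintegral_const_mul' _ _ enorm_ne_top]
        by_cases ht : φ t = 0
        · simp [ht]
        · gcongr
          exact (hlp _).1 (h t ht)
    _ = ε ^ q := by
        rw [lintegral_mul_const _ hφ.measurable.enorm, hmass, one_mul]

/-- A function in `L^p` is little affected by a cutoff that equals one on a large ball. -/
theorem MeasureTheory.MemLp.exists_eLpNorm_cutoff_sub_le [NormedSpace ℝ E] {p : ℝ≥0∞}
    (hp : p ≠ ∞) {u : G → E} (hu : MemLp u p μ) {ε : ℝ≥0∞} (hε : ε ≠ 0) :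
    ∃ R : ℝ, ∀ χ : G → ℝ, (∀ x, χ x ∈ Set.Icc 0 1) → (∀ x, ‖x‖ ≤ R → χ x = 1) →
      eLpNorm (fun x => χ x • u x - u x) p μ ≤ ε := by
  obtain ⟨v, hvc, hv, -, -⟩ := hu.exists_hasCompactSupport_eLpNorm_sub_le hp hε
  obtain ⟨R, hR⟩ := hvc.isCompact.isBounded.exists_norm_le
  refine ⟨R, fun χ h01 h1 => le_trans (eLpNorm_mono fun x => ?_) hv⟩
  by_cases hx : x ∈ tsupport v
  · simp [h1 x (hR x hx)]
  · have h2 : χ x • u x - u x = (χ x - 1) • u x := by rw [sub_smul, one_smul]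
    rw [h2, norm_smul, Pi.sub_apply, image_eq_zero_of_notMem_tsupport hx, sub_zero]
    refine mul_le_of_le_one_left (norm_nonneg _) ?_
    rw [Real.norm_eq_abs, abs_le]
    constructor <;> linarith [(h01 x).1, (h01 x).2]

end Mollification

/-- Smooth compactly supported cutoffs equal to one on a large ball with small derivative. -/
theorem exists_contDiff_cutoff {G : Type*} [NormedAddCommGroup G] [InnerProductSpace ℝ G]
    [FiniteDimensional ℝ G] (R : ℝ) {c : ℝ} (hc : 0 < c) :
    ∃ χ : G → ℝ, ContDiff ℝ (⊤ : ℕ∞) χ ∧ HasCompactSupport χ ∧ (∀ x, χ x ∈ Set.Icc 0 1) ∧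
      (∀ x, ‖x‖ ≤ R → χ x = 1) ∧ ∀ x, ‖fderiv ℝ χ x‖ ≤ c := by
  let b : ContDiffBump (0 : G) := ⟨1, 2, one_pos, one_lt_two⟩
  have hb : ContDiff ℝ (⊤ : ℕ∞) b := b.contDiff
  obtain ⟨C, hC⟩ := (hb.continuous_fderiv (by simp)).bounded_above_of_compact_support
    (b.hasCompactSupport.fderiv ℝ)
  have hC0 : 0 ≤ C := (norm_nonneg _).trans (hC 0)
  let k : ℝ := (|R| + C / c + 1)⁻¹
  have hk : 0 < k := by positivity
  refine ⟨fun x => b (k • x), hb.comp (by fun_prop), ?_, fun x => ⟨b.nonneg, b.le_one⟩, ?_, ?_⟩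
  · exact b.hasCompactSupport.comp_smul hk.ne'
  · intro x hx
    refine b.one_of_mem_closedBall ?_
    rw [mem_closedBall_zero_iff, norm_smul, Real.norm_of_nonneg hk.le]
    change (|R| + C / c + 1)⁻¹ * ‖x‖ ≤ 1
    rw [inv_mul_le_iff₀ (by positivity)]
    have := le_abs_self R
    have : 0 ≤ C / c := by positivity
    linarith
  · intro x
    rw [fderiv_comp_smul, norm_smul, Real.norm_of_nonneg hk.le]
    refine (mul_le_mul_of_nonneg_left (hC _) hk.le).trans ?_
    change (|R| + C / c + 1)⁻¹ * C ≤ c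
    rw [inv_mul_le_iff₀ (by positivity)]
    have h1 : C / c * c = C := div_mul_cancel₀ _ hc.ne'
    have := abs_nonneg R
    nlinarith

section WeakDerivative

open ContinuousLinearMap Convolution

variable {G E : Type*} [NormedAddCommGroup G] [InnerProductSpace ℝ G] [FiniteDimensional ℝ G]
  [MeasurableSpace G] [BorelSpace G]
  [NormedAddCommGroup E] [NormedSpace ℝ E]

/-- The convolution of `φ` with `u`. -/
noncomputable def mollify (φ : G → ℝ) (u : G → E) (x : G) : E :=
  ∫ t, φ t • u (x - t)

theorem contDiff_mollify {φ : G → ℝ} (hφ : ContDiff ℝ (⊤ : ℕ∞) φ) (hφc : HasCompactSupport φ)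
    {u : G → E} (hu : LocallyIntegrable u) : ContDiff ℝ (⊤ : ℕ∞) (mollify φ u) :=
  hφc.contDiff_convolution_left (lsmul ℝ ℝ) hφ hu

theorem integrable_mollify_integrand {φ : G → ℝ} (hφ : Continuous φ) (hφc : HasCompactSupport φ)
    {u : G → E} (hu : LocallyIntegrable u) (x : G) :
    Integrable (fun t => φ t • u (x - t)) :=
  hφc.convolutionExists_left (lsmul ℝ ℝ) hφ hu x

theorem mollify_eq_swap (φ : G → ℝ) (u : G → E) (x : G) :
    mollify φ u x = ∫ t, φ (x - t) • u t :=
  convolution_lsmul_swap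

theorem fderiv_mollify_apply {φ : G → ℝ} (hφ : ContDiff ℝ (⊤ : ℕ∞) φ)
    (hφc : HasCompactSupport φ) {u : G → E} (hu : LocallyIntegrable u) (x v : G) :
    fderiv ℝ (mollify φ u) x v = mollify (fun t => fderiv ℝ φ t v) u x := by
  have h := hφc.hasFDerivAt_convolution_left (lsmul ℝ ℝ) (hφ.of_le (by simp)) hu x
  have hi := (hφc.fderiv ℝ).convolutionExists_left ((lsmul ℝ ℝ : ℝ →L[ℝ] E →L[ℝ] E).precompL G)
    (hφ.continuous_fderiv (by simp)) hu x
  change fderiv ℝ (φ ⋆[lsmul ℝ ℝ] u) x v = _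
  rw [h.fderiv, convolution, ContinuousLinearMap.integral_apply hi.integrable]
  rfl

/-- If `b` is the weak divergence of `∑ i, a i • e i` on `U`, then the mollification of `b` is the
divergence of the mollified field wherever mollifying only involves values in `U`. -/
theorem sum_fderiv_mollify_indicator {ι : Type*} [Fintype ι] {U : Set G} (hU : MeasurableSet U)
    {a : ι → G → ℝ} {b : G → ℝ} {e : ι → G}
    (ha : ∀ i, LocallyIntegrable (U.indicator (a i)))
    (hab : ∀ ψ : G → ℝ, ContDiff ℝ (⊤ : ℕ∞) ψ → HasCompactSupport ψ → tsupport ψ ⊆ U →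
      ∫ x in U, ∑ i, a i x * fderiv ℝ ψ x (e i) = -∫ x in U, b x * ψ x)
    {φ : G → ℝ} (hφ : ContDiff ℝ (⊤ : ℕ∞) φ) (hφc : HasCompactSupport φ) {x : G}
    (hx : ∀ y, x - y ∈ tsupport φ → y ∈ U) :
    ∑ i, fderiv ℝ (mollify φ (U.indicator (a i))) x (e i) = mollify φ (U.indicator b) x := by
  have hψ := hab (fun y => φ (x - y)) (hφ.comp (by fun_prop))
    (hφc.comp_homeomorph (Homeomorph.subLeft x))
    ((tsupport_comp_subset_preimage φ (by fun_prop : Continuous fun y => x - y)).trans hx)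
  have hd : ∀ y v, fderiv ℝ (fun y => φ (x - y)) y v = -fderiv ℝ φ (x - y) v := fun y v => by
    have h := ((hφ.differentiable (by simp)) (x - y)).hasFDerivAt.comp y
      ((hasFDerivAt_id y).const_sub x)
    rw [HasFDerivAt.fderiv (f := fun y => φ (x - y)) h]
    simp
  have hi : ∀ i, Integrable fun t => fderiv ℝ φ (x - t) (e i) • U.indicator (a i) t := fun i => by
    have h := integrable_mollify_integrand (φ := fun t => fderiv ℝ φ t (e i))
      ((hφ.continuous_fderiv (by simp)).clm_apply continuous_const)
      (hφc.fderiv_apply ℝ (e i)) (ha i) x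
    simpa using h.comp_sub_left x
  simp_rw [fderiv_mollify_apply hφ hφc (ha _), mollify_eq_swap]
  rw [← integral_finsetSum _ fun i _ => hi i]
  have h1 : ∀ t, ∑ i, fderiv ℝ φ (x - t) (e i) • U.indicator (a i) t =
      U.indicator (fun t => -∑ i, a i t * fderiv ℝ (fun y => φ (x - y)) t (e i)) t := fun t => by
    by_cases ht : t ∈ U <;> simp [ht, hd, mul_comm]
  have h2 : ∀ t, φ (x - t) • U.indicator b t = U.indicator (fun t => b t * φ (x - t)) t :=
    fun t => by by_cases ht : t ∈ U <;> simp [ht, mul_comm]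
  simp_rw [h1, h2, integral_indicator hU, integral_neg]
  rw [hψ, neg_neg]

end WeakDerivative

section Mollifier

theorem lqNorm_restrict_le {α : Type*} [MeasurableSpace α] {μ : Measure α} {E : Type*}
    [NormedAddCommGroup E] {U : Set α} (hU : MeasurableSet U) {q : ℝ} (hq : 0 < q) {w v : α → E}
    (hwv : ∀ x ∈ U, w x = v x) (hv : AEStronglyMeasurable v μ) {a : ℝ} (ha : 0 ≤ a)
    (hva : eLpNorm v (ENNReal.ofReal q) μ ≤ ENNReal.ofReal a) :
    LqNorm (μ.restrict U) q w ≤ a := by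
  have h0 : LqNorm (μ.restrict U) q w = LqNorm (μ.restrict U) q v := by
    unfold LqNorm
    rw [setIntegral_congr_fun (g := fun x => ‖v x‖ ^ q) hU fun x hx => by simp only [hwv x hx]]
  have h1 := (eLpNorm_mono_measure (p := ENNReal.ofReal q) v
    (Measure.restrict_le_self (μ := μ) (s := U))).trans hva
  have hm : MemLp v (ENNReal.ofReal q) (μ.restrict U) :=
    ⟨hv.restrict, h1.trans_lt ENNReal.ofReal_lt_top⟩
  rw [hm.eLpNorm_eq_integral_rpow_norm (by simpa using hq) ENNReal.ofReal_ne_top,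
    ENNReal.toReal_ofReal hq.le, ENNReal.ofReal_le_ofReal_iff ha] at h1
  rw [h0, LqNorm, one_div]
  exact h1

/-- Cutting off an approximation of `u` approximates `u`, up to an additional small term. -/
theorem eLpNorm_cutoff_sub_add_le {α : Type*} [MeasurableSpace α] {μ : Measure α} {E E' : Type*}
    [NormedAddCommGroup E] [NormedSpace ℝ E] [NormedAddCommGroup E'] {p : ℝ≥0∞} (hp : 1 ≤ p)
    {χ : α → ℝ} {u v b : α → E} {z z' : α → E'} {ε c M : ℝ} (hε : 0 ≤ ε) (hc : 0 ≤ c)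
    (hM : 0 ≤ M) (hχm : AEStronglyMeasurable χ μ)
    (hχ : ∀ x, χ x ∈ Set.Icc 0 1) (hu : AEStronglyMeasurable u μ) (hv : AEStronglyMeasurable v μ)
    (hb : AEStronglyMeasurable b μ) (hz : AEStronglyMeasurable z μ)
    (hz' : AEStronglyMeasurable z' μ)
    (hvu : eLpNorm (fun x => v x - u x) p μ ≤ ENNReal.ofReal ε)
    (hχu : eLpNorm (fun x => χ x • u x - u x) p μ ≤ ENNReal.ofReal ε)
    (hzz' : eLpNorm (fun x => z' x - z x) p μ ≤ ENNReal.ofReal ε)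
    (hzM : eLpNorm z p μ ≤ ENNReal.ofReal M) (hbz : ∀ x, ‖b x‖ ≤ c * ‖z' x‖) :
    eLpNorm (fun x => χ x • v x - u x + b x) p μ ≤ ENNReal.ofReal (2 * ε + c * (M + ε)) := by
  have h1 : eLpNorm (fun x => χ x • (v x - u x)) p μ ≤ ENNReal.ofReal ε := by
    refine (eLpNorm_mono fun x => ?_).trans hvu
    rw [norm_smul, Real.norm_of_nonneg (hχ x).1]
    exact mul_le_of_le_one_left (norm_nonneg _) (hχ x).2
  have h2 : eLpNorm z' p μ ≤ ENNReal.ofReal (M + ε) := by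
    have h : z' = z + fun x => z' x - z x := by ext x; simp
    rw [h, ENNReal.ofReal_add hM hε]
    exact (eLpNorm_add_le hz (hz'.sub hz) hp).trans (add_le_add hzM hzz')
  have h3 : eLpNorm b p μ ≤ ENNReal.ofReal (c * (M + ε)) := by
    refine (eLpNorm_le_mul_eLpNorm_of_ae_le_mul (.of_forall hbz) p).trans ?_
    rw [ENNReal.ofReal_mul hc]
    gcongr
  have h : (fun x => χ x • v x - u x + b x) =
      ((fun x => χ x • (v x - u x)) + fun x => χ x • u x - u x) + b := by
    ext x
    simp [smul_sub]
  rw [h, ENNReal.ofReal_add (by positivity) (by positivity), two_mul,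
    ENNReal.ofReal_add hε hε]
  have hm1 := hχm.smul (hv.sub hu)
  have hm2 := (hχm.smul hu).sub hu
  exact (eLpNorm_add_le (hm1.add hm2) hb hp).trans
    (add_le_add ((eLpNorm_add_le hm1 hm2 hp).trans (add_le_add h1 hχu)) h3)

theorem measurableSet_upperHalf (N : ℕ) (hN : 1 ≤ N) : MeasurableSet (upperHalf N hN) :=
  (isOpen_lt continuous_const (by fun_prop)).measurableSet

/-- Smooth mollifiers of small support whose convolution only looks upwards in `x_N`. -/
theorem exists_mollifier_upperHalf (N : ℕ) (hN : 1 ≤ N) {r : ℝ} (hr : 0 < r) :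
    ∃ φ : EuclideanSpace ℝ (Fin N) → ℝ, ContDiff ℝ (⊤ : ℕ∞) φ ∧ HasCompactSupport φ ∧
      (∀ t, 0 ≤ φ t) ∧ ∫ t, φ t = 1 ∧ (∀ t, φ t ≠ 0 → ‖t‖ < r) ∧
      ∀ x ∈ upperHalf N hN, ∀ y, x - y ∈ tsupport φ → y ∈ upperHalf N hN := by
  let i : Fin N := ⟨N - 1, by omega⟩
  let c : EuclideanSpace ℝ (Fin N) := EuclideanSpace.single i (-(r / 2))
  let b : ContDiffBump c := ⟨r / 8, r / 4, by positivity, by linarith⟩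
  refine ⟨b.normed volume, b.contDiff_normed, b.hasCompactSupport_normed, b.nonneg_normed,
    b.integral_normed, fun t ht => ?_, fun x hx y hy => ?_⟩
  · have h1 : t ∈ Metric.ball c (r / 4) := by
      have : t ∈ Function.support (b.normed volume) := ht
      rwa [b.support_normed_eq] at this
    rw [mem_ball_iff_norm] at h1
    have h2 : ‖c‖ = r / 2 := by
      simp only [c, PiLp.norm_single, norm_neg, Real.norm_eq_abs]
      rw [abs_of_pos (by positivity)]
    have h3 := norm_add_le (t - c) c
    rw [sub_add_cancel] at h3
    linarith
  · rw [b.tsupport_normed_eq, mem_closedBall_iff_norm] at hy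
    have h1 := (PiLp.norm_apply_le (x - y - c) i).trans hy
    have h2 : (x - y - c) i = x i - y i + r / 2 := by simp [c]
    rw [h2, Real.norm_eq_abs, abs_le] at h1
    have h3 : 0 < x i := hx
    have h4 : x i - y i + r / 2 ≤ r / 4 := h1.2
    change 0 < y i
    linarith

end Mollifier

/-- Lemma 2.1 (density): if `f, g, h ∈ L^q(ℝ^N_+)` with `g = div f` and `h = ∇f_N`
distributionally on `ℝ^N_+`, then `f` can be approximated in the `F_q(ℝ^N_+)` norm by
restrictions of smooth compactly supported vector fields on `ℝ^N`. -/
theorem stmt_15 (N : ℕ) (hN : 1 ≤ N) (q : ℝ) (hq : 1 < q)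
    (f : EuclideanSpace ℝ (Fin N) → EuclideanSpace ℝ (Fin N))
    (g : EuclideanSpace ℝ (Fin N) → ℝ)
    (h : EuclideanSpace ℝ (Fin N) → EuclideanSpace ℝ (Fin N))
    (hf : MemLp f (ENNReal.ofReal q) (volume.restrict (upperHalf N hN)))
    (hg : MemLp g (ENNReal.ofReal q) (volume.restrict (upperHalf N hN)))
    (hh : MemLp h (ENNReal.ofReal q) (volume.restrict (upperHalf N hN)))
    (hdiv : ∀ ψ : EuclideanSpace ℝ (Fin N) → ℝ, ContDiff ℝ (⊤ : ℕ∞) ψ → HasCompactSupport ψ →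
      tsupport ψ ⊆ upperHalf N hN →
      (∫ x in upperHalf N hN,
          ∑ j : Fin N, f x j * fderiv ℝ ψ x (EuclideanSpace.single j 1)) =
        -∫ x in upperHalf N hN, g x * ψ x)
    (hgrad : ∀ ψ : EuclideanSpace ℝ (Fin N) → ℝ, ContDiff ℝ (⊤ : ℕ∞) ψ → HasCompactSupport ψ →
      tsupport ψ ⊆ upperHalf N hN → ∀ j : Fin N,
      (∫ x in upperHalf N hN,
          f x ⟨N - 1, by omega⟩ * fderiv ℝ ψ x (EuclideanSpace.single j 1)) =
        -∫ x in upperHalf N hN, h x j * ψ x) :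
    ∀ δ : ℝ, 0 < δ →
      ∃ F : EuclideanSpace ℝ (Fin N) → EuclideanSpace ℝ (Fin N),
        ContDiff ℝ (⊤ : ℕ∞) F ∧ HasCompactSupport F ∧
        LqNorm (volume.restrict (upperHalf N hN)) q (fun x => F x - f x) +
          LqNorm (volume.restrict (upperHalf N hN)) q (fun x =>
            (∑ j : Fin N, fderiv ℝ (fun y => F y j) x (EuclideanSpace.single j 1)) - g x) +
          LqNorm (volume.restrict (upperHalf N hN)) q (fun x =>
            F x ⟨N - 1, by omega⟩ - f x ⟨N - 1, by omega⟩) +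
          LqNorm (volume.restrict (upperHalf N hN)) q (fun x =>
            (WithLp.equiv 2 (Fin N → ℝ)).symm (fun j =>
              fderiv ℝ (fun y => F y ⟨N - 1, by omega⟩) x (EuclideanSpace.single j 1)) -
              h x) < δ := by
  intro δ hδ
  let U := upperHalf N hN
  let n : Fin N := ⟨N - 1, by omega⟩
  have hU : MeasurableSet U := measurableSet_upperHalf N hN
  have hq0 : 0 < q := by linarith
  have hp : 1 ≤ ENNReal.ofReal q := by simpa using hq.le
  have hp' : ENNReal.ofReal q ≠ ∞ := ENNReal.ofReal_ne_top
  let f₀ := U.indicator f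
  let g₀ := U.indicator g
  let h₀ := U.indicator h
  have hf₀ : MemLp f₀ (ENNReal.ofReal q) volume := (memLp_indicator_iff_restrict hU).2 hf
  have hg₀ : MemLp g₀ (ENNReal.ofReal q) volume := (memLp_indicator_iff_restrict hU).2 hg
  have hh₀ : MemLp h₀ (ENNReal.ofReal q) volume := (memLp_indicator_iff_restrict hU).2 hh
  have hfl := hf₀.locallyIntegrable hp
  have hgl := hg₀.locallyIntegrable hp
  have hhl := hh₀.locallyIntegrable hp
  let M := (eLpNorm f₀ (ENNReal.ofReal q) volume).toReal
  have hM : 0 ≤ M := ENNReal.toReal_nonneg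
  have hfM : eLpNorm f₀ (ENNReal.ofReal q) volume ≤ ENNReal.ofReal M :=
    (ENNReal.ofReal_toReal hf₀.eLpNorm_ne_top).ge
  let ε := δ / 20
  have hε : 0 < ε := by positivity
  have hε' : ENNReal.ofReal ε ≠ 0 := by simpa using hε
  let c := ε / (M + ε)
  have hc : 0 < c := by positivity
  have hcM : c * (M + ε) = ε := div_mul_cancel₀ _ (by positivity)
  obtain ⟨r₁, hr₁, hfr⟩ := hf₀.exists_eLpNorm_translate_sub_le hp hp' hε'
  obtain ⟨r₂, hr₂, hgr⟩ := hg₀.exists_eLpNorm_translate_sub_le hp hp' hε'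
  obtain ⟨r₃, hr₃, hhr⟩ := hh₀.exists_eLpNorm_translate_sub_le hp hp' hε'
  obtain ⟨φ, hφ, hφc, hφ0, hφ1, hφr, hφU⟩ :=
    exists_mollifier_upperHalf N hN (lt_min hr₁ (lt_min hr₂ hr₃))
  obtain ⟨R₁, hfR⟩ := hf₀.exists_eLpNorm_cutoff_sub_le hp' hε'
  obtain ⟨R₂, hgR⟩ := hg₀.exists_eLpNorm_cutoff_sub_le hp' hε'
  obtain ⟨R₃, hhR⟩ := hh₀.exists_eLpNorm_cutoff_sub_le hp' hε'
  obtain ⟨χ, hχ, hχc, hχ01, hχ1, hχd⟩ := exists_contDiff_cutoff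
    (G := EuclideanSpace ℝ (Fin N)) (max R₁ (max R₂ R₃)) hc
  have hfχ := hfR χ hχ01 fun x hx => hχ1 x (hx.trans (by simp))
  have hgχ := hgR χ hχ01 fun x hx => hχ1 x (hx.trans (by simp))
  have hhχ := hhR χ hχ01 fun x hx => hχ1 x (hx.trans (by simp))
  have hfφ : eLpNorm (fun x => mollify φ f₀ x - f₀ x) _ _ ≤ _ :=
    eLpNorm_integral_smul_translate_sub_le hq.le hf₀ hφ.continuous hφc hφ0 hφ1
      fun t ht => hfr t ((hφr t ht).trans_le (by simp))
  have hgφ : eLpNorm (fun x => mollify φ g₀ x - g₀ x) _ _ ≤ _ :=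
    eLpNorm_integral_smul_translate_sub_le hq.le hg₀ hφ.continuous hφc hφ0 hφ1
      fun t ht => hgr t ((hφr t ht).trans_le (by simp))
  have hhφ : eLpNorm (fun x => mollify φ h₀ x - h₀ x) _ _ ≤ _ :=
    eLpNorm_integral_smul_translate_sub_le hq.le hh₀ hφ.continuous hφc hφ0 hφ1
      fun t ht => hhr t ((hφr t ht).trans_le (by simp))
  have hfs := contDiff_mollify hφ hφc hfl
  have hgs := contDiff_mollify hφ hφc hgl
  have hhs := contDiff_mollify hφ hφc hhl
  have hcoord : ∀ {k : EuclideanSpace ℝ (Fin N) → EuclideanSpace ℝ (Fin N)} (j : Fin N) x,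
      U.indicator (fun y => k y j) x = U.indicator k x j := fun j x => by
    by_cases hx : x ∈ U <;> simp [hx]
  have hcoordL : ∀ j, LocallyIntegrable (U.indicator fun y => f y j) := fun j => by
    have h1 : MemLp (fun x => f x j) (ENNReal.ofReal q) (volume.restrict U) :=
      (EuclideanSpace.proj j : EuclideanSpace ℝ (Fin N) →L[ℝ] ℝ).comp_memLp' hf
    exact ((memLp_indicator_iff_restrict hU).2 h1).locallyIntegrable hp
  have hmcoord : ∀ {k : EuclideanSpace ℝ (Fin N) → EuclideanSpace ℝ (Fin N)},
      LocallyIntegrable (U.indicator k) → ∀ (j : Fin N) x,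
      mollify φ (U.indicator k) x j = mollify φ (U.indicator fun y => k y j) x := by
    intro k hk j x
    have h1 := (EuclideanSpace.proj j : EuclideanSpace ℝ (Fin N) →L[ℝ] ℝ).integral_comp_comm
      (integrable_mollify_integrand hφ.continuous hφc hk x)
    simp only [mollify, hcoord]
    simpa using h1.symm
  have hmf : ∀ j, (fun x => mollify φ f₀ x j) = mollify φ (U.indicator fun y => f y j) :=
    fun j => funext (hmcoord hfl j)
  have hderiv : ∀ j x (v : EuclideanSpace ℝ (Fin N)),
      fderiv ℝ (fun y => (χ y • mollify φ f₀ y) j) x v =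
        χ x * fderiv ℝ (mollify φ (U.indicator fun y => f y j)) x v +
          mollify φ f₀ x j * fderiv ℝ χ x v := by
    intro j x v
    have h1 := (hχ.differentiable (by simp) x).hasFDerivAt.mul
      ((contDiff_mollify hφ hφc (hcoordL j)).differentiable (by simp) x).hasFDerivAt
    have h2 : (fun y => (χ y • mollify φ f₀ y) j) =
        fun y => χ y * mollify φ (U.indicator fun y => f y j) y := by
      ext y
      rw [← hmf]
      simp
    rw [h2, HasFDerivAt.fderiv (f := fun y => χ y * _) h1, ← hmf]
    simp
  have hdivφ : ∀ x ∈ U, ∑ j, fderiv ℝ (mollify φ (U.indicator fun y => f y j)) x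
      (EuclideanSpace.single j 1) = mollify φ g₀ x := fun x hx =>
    sum_fderiv_mollify_indicator hU (a := fun j y => f y j) hcoordL hdiv hφ hφc (hφU x hx)
  have hgradφ : ∀ x ∈ U, ∀ j, fderiv ℝ (mollify φ (U.indicator fun y => f y n)) x
      (EuclideanSpace.single j 1) = mollify φ h₀ x j := fun x hx j => by
    have h1 := sum_fderiv_mollify_indicator (ι := Unit) hU (a := fun _ y => f y n)
      (b := fun y => h y j) (e := fun _ => EuclideanSpace.single j 1) (fun _ => hcoordL n)
      (fun ψ h1 h2 h3 => by simpa using hgrad ψ h1 h2 h3 j) hφ hφc (hφU x hx)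
    rw [hmcoord hhl]
    simpa using h1
  have hcont : ∀ x, ‖(0 : EuclideanSpace ℝ (Fin N))‖ ≤ c * ‖mollify φ f₀ x‖ := fun x => by
    rw [norm_zero]
    positivity
  have hF : eLpNorm (fun x => χ x • mollify φ f₀ x - f₀ x + 0) (ENNReal.ofReal q) volume ≤
      ENNReal.ofReal (3 * ε) :=
    (eLpNorm_cutoff_sub_add_le hp hε.le hc.le hM hχ.continuous.aestronglyMeasurable hχ01 hf₀.1
      hfs.continuous.aestronglyMeasurable aestronglyMeasurable_const hf₀.1
      hfs.continuous.aestronglyMeasurable hfφ hfχ hfφ hfM hcont).trans_eq (by rw [hcM]; ring_nf)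
  have hFm : AEStronglyMeasurable (fun x => χ x • mollify φ f₀ x - f₀ x + 0) volume :=
    (((hχ.smul hfs).continuous.aestronglyMeasurable).sub hf₀.1).add aestronglyMeasurable_const
  have hdc : Continuous fun x => fderiv ℝ χ x (mollify φ f₀ x) :=
    (hχ.continuous_fderiv (by simp)).clm_apply hfs.continuous
  have hD := eLpNorm_cutoff_sub_add_le (b := fun x => fderiv ℝ χ x (mollify φ f₀ x)) hp hε.le
    hc.le hM hχ.continuous.aestronglyMeasurable hχ01 hg₀.1
    hgs.continuous.aestronglyMeasurable hdc.aestronglyMeasurable hf₀.1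
    hfs.continuous.aestronglyMeasurable hgφ hgχ hfφ hfM fun x =>
      ((fderiv ℝ χ x).le_opNorm _).trans (by gcongr; exact hχd x)
  have hgc : Continuous fun x => mollify φ f₀ x n • gradient χ x :=
    ((EuclideanSpace.proj n : EuclideanSpace ℝ (Fin N) →L[ℝ] ℝ).continuous.comp
      hfs.continuous).smul ((InnerProductSpace.toDual ℝ _).symm.continuous.comp
        (hχ.continuous_fderiv (by simp)))
  have hG := eLpNorm_cutoff_sub_add_le (b := fun x => mollify φ f₀ x n • gradient χ x) hp hε.le
    hc.le hM hχ.continuous.aestronglyMeasurable hχ01 hh₀.1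
    hhs.continuous.aestronglyMeasurable hgc.aestronglyMeasurable hf₀.1
    hfs.continuous.aestronglyMeasurable hhφ hhχ hfφ hfM fun x => by
      rw [norm_smul, mul_comm]
      have h1 : ‖gradient χ x‖ ≤ c := by
        rw [gradient, LinearIsometryEquiv.norm_map]
        exact hχd x
      exact mul_le_mul h1 (PiLp.norm_apply_le _ n) (norm_nonneg _) hc.le
  have hgradj : ∀ x j, gradient χ x j = fderiv ℝ χ x (EuclideanSpace.single j 1) := fun x j => by
    have h1 : inner ℝ (gradient χ x) (EuclideanSpace.single j 1) =
        fderiv ℝ χ x (EuclideanSpace.single j 1) :=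
      InnerProductSpace.toDual_symm_apply
    rw [← h1, EuclideanSpace.inner_single_right]
    simp
  have hε3 : 2 * ε + c * (M + ε) = 3 * ε := by rw [hcM]; ring
  rw [hε3] at hD hG
  refine ⟨fun x => χ x • mollify φ f₀ x, hχ.smul hfs, hχc.smul_right, ?_⟩
  have e1 := lqNorm_restrict_le hU hq0 (w := fun x => χ x • mollify φ f₀ x - f x)
    (fun x hx => by simp [f₀, hx]) hFm (by positivity) hF
  have e2 := lqNorm_restrict_le hU hq0 (w := fun x =>
      (∑ j : Fin N, fderiv ℝ (fun y => (χ y • mollify φ f₀ y) j) x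
        (EuclideanSpace.single j 1)) - g x)
    (v := fun x => χ x • mollify φ g₀ x - g₀ x + fderiv ℝ χ x (mollify φ f₀ x))
    (fun x hx => by
      have h1 : ∑ j, mollify φ f₀ x j * fderiv ℝ χ x (EuclideanSpace.single j 1) =
          fderiv ℝ χ x (mollify φ f₀ x) := by
        conv_rhs => rw [← (EuclideanSpace.basisFun (Fin N) ℝ).sum_repr (mollify φ f₀ x)]
        simp [map_sum]
      have h2 : g₀ x = g x := Set.indicator_of_mem hx g
      simp only [hderiv]
      rw [Finset.sum_add_distrib, ← Finset.mul_sum, hdivφ x hx, h1, ← h2]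
      simp only [smul_eq_mul]
      ring)
    ((((hχ.smul hgs).continuous.aestronglyMeasurable).sub hg₀.1).add hdc.aestronglyMeasurable)
    (by positivity) hD
  have e3 := lqNorm_restrict_le hU hq0
    (w := fun x => (χ x • mollify φ f₀ x) n - f x n)
    (v := fun x => (χ x • mollify φ f₀ x - f₀ x + 0) n)
    (fun x hx => by simp [f₀, hx])
    ((EuclideanSpace.proj n : EuclideanSpace ℝ (Fin N) →L[ℝ] ℝ).continuous.comp_aestronglyMeasurable
      hFm)
    (by positivity) ((eLpNorm_mono fun x => PiLp.norm_apply_le _ n).trans hF)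
  have e4 := lqNorm_restrict_le hU hq0 (w := fun x =>
      (WithLp.equiv 2 (Fin N → ℝ)).symm (fun j =>
        fderiv ℝ (fun y => (χ y • mollify φ f₀ y) n) x (EuclideanSpace.single j 1)) - h x)
    (v := fun x => χ x • mollify φ h₀ x - h₀ x + mollify φ f₀ x n • gradient χ x)
    (fun x hx => by
      have h2 : h₀ x = h x := Set.indicator_of_mem hx h
      simp only [hderiv, hgradφ x hx]
      ext j
      simp only [h2, WithLp.equiv_symm_apply, PiLp.sub_apply, PiLp.add_apply,
        PiLp.smul_apply, smul_eq_mul, hgradj]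
      ring)
    ((((hχ.smul hhs).continuous.aestronglyMeasurable).sub hh₀.1).add hgc.aestronglyMeasurable)
    (by positivity) hG
  have hsum : 3 * ε + 3 * ε + 3 * ε + 3 * ε < δ := by
    change 3 * (δ / 20) + 3 * (δ / 20) + 3 * (δ / 20) + 3 * (δ / 20) < δ
    linarith
  exact (add_le_add (add_le_add (add_le_add e1 e2) e3) e4).trans_lt hsum
end
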